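/- arXiv:2102.07042 — 3 statements merged into one kernel-verified Lean document; each statement's English description precedes it below -/
import Mathlib

section
/- Let M and N be injective right modules over a ring A such that there exist injective module homomorphisms M → N and N → M. Then M and N are isomorphic. -/
/-- A relative pseudo-complement, by Zorn's lemma. -/
theorem exists_max_disjoint_aux {R N : Type*} [Ring R] [AddCommGroup N] [Module R N]
    (F : Submodule R N) : ∃ D : Submodule R N, Maximal (fun D => Disjoint F D) D := by
  obtain ⟨D, hD⟩ := zorn_le₀ {D : Submodule R N | Disjoint F D} (by
    intro c hc hch
    refine ⟨sSup c, ?_, fun z hz => le_sSup hz⟩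
    change Disjoint F (sSup c)
    rw [hch.directedOn.disjoint_sSup_right]
    exact fun b hb => hc hb)
  exact ⟨D, hD⟩

theorem max_disjoint_essential_aux {R N : Type*} [Ring R] [AddCommGroup N] [Module R N]
    (F D L : Submodule R N) (hD : Maximal (fun D => Disjoint F D) D)
    (hL : Disjoint L (F ⊔ D)) : L = ⊥ := by
  have hFD : Disjoint F D := hD.prop
  have h1 : Disjoint F (L ⊔ D) := by
    rw [Submodule.disjoint_def]
    intro x hx hx'
    obtain ⟨l, hl, d, hd, rfl⟩ := Submodule.mem_sup.1 hx'
    have hl0 : l = 0 := by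
      refine Submodule.disjoint_def.1 hL l hl ?_
      have := Submodule.sub_mem _ (Submodule.mem_sup_left (T := D) hx)
        (Submodule.mem_sup_right (S := F) hd)
      simpa using this
    subst hl0
    exact Submodule.disjoint_def.1 hFD _ hx (by simpa using hd)
  have h2 : L ⊔ D ≤ D := hD.le_of_ge h1 le_sup_right
  exact hL.eq_bot_of_le ((le_sup_left.trans h2).trans le_sup_right)

/-- Bumby's theorem: injective right `A`-modules (modules over `Aᵐᵒᵖ`) admitting
injective homomorphisms into each other are isomorphic. -/
theorem stmt14 (A : Type*) [Ring A]
    (M N : Type*) [AddCommGroup M] [AddCommGroup N]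
    [Module Aᵐᵒᵖ M] [Module Aᵐᵒᵖ N]
    (hM : Module.Injective Aᵐᵒᵖ M) (hN : Module.Injective Aᵐᵒᵖ N)
    (f : M →ₗ[Aᵐᵒᵖ] N) (hf : Function.Injective f)
    (g : N →ₗ[Aᵐᵒᵖ] M) (hg : Function.Injective g) :
    Nonempty (M ≃ₗ[Aᵐᵒᵖ] N) := by
  -- a retraction of g
  obtain ⟨r, hr⟩ : ∃ r : M →ₗ[Aᵐᵒᵖ] N, ∀ n, r (g n) = n := by
    obtain ⟨h, hh⟩ := hN.out (f.rangeRestrict ∘ₗ g)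
      (by
        intro x y hxy
        exact hg (hf (congrArg Subtype.val hxy))) LinearMap.id
    exact ⟨h ∘ₗ f.rangeRestrict, hh⟩
  obtain ⟨S, hS1, hS2, hS3⟩ : ∃ S : Submodule Aᵐᵒᵖ M, LinearMap.ker r ≤ S ∧
      (∀ s ∈ S, r s ∈ S.map f) ∧ (∀ s ∈ S, g (f s) ∈ S) := by
    let φ : Module.End Aᵐᵒᵖ M := g ∘ₗ f
    let T : ℕ → Submodule Aᵐᵒᵖ M := fun n => (LinearMap.ker r).map (φ ^ n)
    have hT : ∀ n, T (n + 1) = (T n).map φ := by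
      intro n
      simp only [T, pow_succ', Module.End.mul_eq_comp, Submodule.map_comp]
    refine ⟨⨆ n, T n, ?_, ?_, ?_⟩
    · refine le_trans ?_ (le_iSup T 0)
      simp [T, Module.End.one_eq_id]
    · change (⨆ n, T n) ≤ ((⨆ n, T n).map f).comap r
      refine iSup_le fun n => ?_
      cases n with
      | zero =>
        rintro _ ⟨x, hx, rfl⟩
        have : r x = 0 := hx
        simp [this]
      | succ n =>
        rw [hT]
        rintro _ ⟨x, hx, rfl⟩
        refine ⟨x, Submodule.mem_iSup_of_mem n hx, ?_⟩
        simp [φ, hr]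
    · change (⨆ n, T n) ≤ (⨆ n, T n).comap φ
      refine iSup_le fun n => ?_
      rw [← Submodule.map_le_iff_le_comap, ← hT]
      exact le_iSup T (n + 1)
  obtain ⟨D, hD⟩ := exists_max_disjoint_aux (S.map f)
  have hFD : Disjoint (S.map f) D := hD.prop
  have hdis := Submodule.disjoint_def.1 hFD
  -- the extension
  obtain ⟨H, hH⟩ := hM.out
    (S.subtype.coprod (D.map g).subtype)
    (by
      rw [← LinearMap.ker_eq_bot, LinearMap.ker_eq_bot']
      rintro ⟨⟨s, hs⟩, ⟨_, d, hd, rfl⟩⟩ h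
      have h0 : s + g d = 0 := by simpa using h
      have h1 : r s + d = 0 := by simpa [hr] using congrArg r h0
      have h2 : d = 0 := by
        refine hdis d ?_ hd
        rw [eq_neg_of_add_eq_zero_right h1]
        exact Submodule.neg_mem _ (hS2 s hs)
      subst h2
      have h3 : s = 0 := by simpa using h0
      subst h3
      ext <;> simp)
    (((g ∘ₗ f) ∘ₗ S.subtype).coprod (D.map g).subtype)
  let θ : M →ₗ[Aᵐᵒᵖ] N := r ∘ₗ H
  have hθS : ∀ s ∈ S, θ s = f s := by
    intro s hs
    have := hH (⟨s, hs⟩, 0)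
    simp at this
    simp [θ, this, hr]
  have hθD : ∀ d ∈ D, θ (g d) = d := by
    intro d hd
    have := hH (0, ⟨g d, d, hd, rfl⟩)
    simp at this
    simp [θ, this, hr]
  have hθinj : LinearMap.ker θ = ⊥ := by
    have hK : Disjoint (LinearMap.ker θ) (S ⊔ D.map g) := by
      rw [Submodule.disjoint_def]
      intro x hx hx'
      obtain ⟨s, hs, _, ⟨d, hd, rfl⟩, rfl⟩ := Submodule.mem_sup.1 hx'
      have h1 : f s + d = 0 := by
        have : θ (s + g d) = 0 := hx
        rwa [map_add, hθS s hs, hθD d hd] at this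
      have h2 : d = 0 := by
        refine hdis d ?_ hd
        rw [eq_neg_of_add_eq_zero_right h1]
        exact Submodule.neg_mem _ ⟨s, hs, rfl⟩
      subst h2
      have h3 : s = 0 := hf (by simpa using h1)
      simp [h3]
    have hrK : (LinearMap.ker θ).map r = ⊥ := by
      refine max_disjoint_essential_aux _ D _ hD ?_
      rw [Submodule.disjoint_def]
      rintro _ ⟨k, hk, rfl⟩ hx
      obtain ⟨_, ⟨s, hs, rfl⟩, d, hd, h⟩ := Submodule.mem_sup.1 hx
      have hker : k - g (f s) - g d ∈ S := by
        apply hS1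
        rw [LinearMap.mem_ker, map_sub, map_sub, hr, hr, ← h]
        abel
      have hk0 : k = 0 := by
        refine Submodule.disjoint_def.1 hK k hk ?_
        refine Submodule.mem_sup.2 ⟨_, S.add_mem hker (hS3 s hs), g d, ⟨d, hd, rfl⟩, ?_⟩
        abel
      simp [hk0]
    refine hK.eq_bot_of_le (le_trans ?_ (hS1.trans le_sup_left))
    intro k hk
    have : r k ∈ (LinearMap.ker θ).map r := ⟨k, hk, rfl⟩
    rw [hrK] at this
    exact this
  have hθi : Function.Injective θ := LinearMap.ker_eq_bot.1 hθinj
  obtain ⟨h, hh⟩ := hM.out (g ∘ₗ θ) (hg.comp hθi) LinearMap.id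
  have hρ : ∀ x, h (g (θ x)) = x := hh
  have hker : LinearMap.ker (h ∘ₗ g) = ⊥ := by
    refine max_disjoint_essential_aux _ D _ hD ?_
    rw [Submodule.disjoint_def]
    intro x hx hx'
    obtain ⟨_, ⟨s, hs, rfl⟩, d, hd, rfl⟩ := Submodule.mem_sup.1 hx'
    have h1 : f s + d = θ (s + g d) := by rw [map_add, hθS s hs, hθD d hd]
    have h2 : h (g (f s + d)) = 0 := hx
    rw [h1, hρ] at h2
    rw [h1, h2, map_zero]
  have hsurj : Function.Surjective θ := by
    intro n
    refine ⟨h (g n), LinearMap.ker_eq_bot.1 hker ?_⟩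
    simp [hρ]
  exact ⟨LinearEquiv.ofBijective θ ⟨hθi, hsurj⟩⟩
end

section
/- Let C be a Grothendieck abelian category and x an object of C such that every object of C is isomorphic to a coproduct of copies of x. Then every object of C is injective. -/
open CategoryTheory CategoryTheory.Limits

lemma stmt18_retract {C : Type u} [Category.{v} C] [Abelian C]
    [HasColimits C] (x : C) {A B : Type v} (f : A → B) (hf : Function.Injective f) :
    ∃ (i : ∐ (fun _ : A => x) ⟶ ∐ (fun _ : B => x))
      (r : ∐ (fun _ : B => x) ⟶ ∐ (fun _ : A => x)), i ≫ r = 𝟙 _ := by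
  classical
  refine ⟨Sigma.desc (fun a => Sigma.ι (fun _ : B => x) (f a)),
    Sigma.desc (fun b => if h : ∃ a, f a = b then
      Sigma.ι (fun _ : A => x) h.choose else 0), ?_⟩
  refine Sigma.hom_ext _ _ (fun a => ?_)
  have h : ∃ a', f a' = f a := ⟨a, rfl⟩
  have h2 : h.choose = a := hf h.choose_spec
  rw [Sigma.ι_desc_assoc, Sigma.ι_desc, dif_pos h, h2, Category.comp_id]

lemma stmt18_retract_injective {C : Type u} [Category.{v} C] {X Y : C}
    (i : X ⟶ Y) (r : Y ⟶ X) (h : i ≫ r = 𝟙 X) [Injective Y] : Injective X where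
  factors g f _ := ⟨Injective.factorThru (g ≫ i) f ≫ r, by
    rw [← Category.assoc, Injective.comp_factorThru, Category.assoc, h, Category.comp_id]⟩

lemma stmt18_mono_ι {C : Type u} [Category.{v} C] [Abelian C]
    [HasColimits C] (x : C) {A : Type v} (a b : A) :
    ∃ r : ∐ (fun _ : A => x) ⟶ x, Sigma.ι (fun _ : A => x) a ≫ r = 𝟙 x ∧
      (b ≠ a → Sigma.ι (fun _ : A => x) b ≫ r = 0) := by
  classical
  refine ⟨Sigma.desc (fun c => if c = a then 𝟙 x else 0), ?_, ?_⟩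
  · simp
  · intro h
    simp [h]

/-- In a Grothendieck abelian category (abelian, cocomplete, with exact filtered
colimits (AB5) and a separator), if every object is a coproduct of copies of a
fixed object `x`, then every object is injective. -/
theorem stmt18 {C : Type u} [Category.{v} C] [Abelian C]
    [HasColimits C] [HasFilteredColimits C] [AB5 C] [HasSeparator C]
    (x : C)
    (hx : ∀ y : C, ∃ S : Type v, Nonempty (y ≅ ∐ (fun _ : S => x))) :
    ∀ y : C, Injective y := by
  intro y
  haveI : IsGrothendieckAbelian.{v} C := { }
  obtain ⟨K, ⟨e⟩⟩ := hx y
  let P : C := ∐ (fun _ : K => x)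
  let L : Type v := Set (Shrink.{v} (Subobject P))
  let Q : C := ∐ (fun _ : L => x)
  obtain ⟨S, ⟨e'⟩⟩ := hx (Injective.under Q)
  rcases Function.Embedding.total K S with ⟨⟨f, hf⟩⟩ | ⟨⟨f, hf⟩⟩
  · obtain ⟨i, r, hir⟩ := stmt18_retract x f hf
    refine stmt18_retract_injective (Y := Injective.under Q)
      (e.hom ≫ i ≫ e'.inv) (e'.hom ≫ r ≫ e.inv) ?_
    simp [reassoc_of% hir]
  · obtain ⟨i, r, hir⟩ := stmt18_retract x f hf
    haveI : Mono i := mono_of_mono_fac hir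
    let j : Q ⟶ P := Injective.ι Q ≫ e'.hom ≫ i
    haveI : Mono j := inferInstance
    haveI hm : ∀ a : L, Mono (Sigma.ι (fun _ : L => x) a) := fun a => by
      obtain ⟨r, hr, -⟩ := stmt18_mono_ι x a a
      exact mono_of_mono_fac hr
    haveI hm' : ∀ a : L, Mono (Sigma.ι (fun _ : L => x) a ≫ j) := fun a => mono_comp _ _
    let φ : L → Shrink.{v} (Subobject P) := fun a =>
      equivShrink _ (Subobject.mk (Sigma.ι (fun _ : L => x) a ≫ j))
    have hφ : ¬ Function.Injective φ := Function.cantor_injective φ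
    simp only [Function.Injective, not_forall] at hφ
    obtain ⟨a, b, hab, hne⟩ := hφ
    have h1 := (equivShrink _).injective hab
    have h2 := Subobject.ofMkLEMk_comp (le_of_eq h1)
    rw [← Category.assoc, cancel_mono] at h2
    obtain ⟨r, hr, hr'⟩ := stmt18_mono_ι x a b
    have hid : 𝟙 x = 0 := by
      rw [← hr, ← h2, Category.assoc, hr' (Ne.symm hne), comp_zero]
    have hy : 𝟙 y = 0 := by
      rw [← e.hom_inv_id]
      have : e.inv = 0 := Sigma.hom_ext _ _ (fun k => by
        rw [comp_zero, ← Category.id_comp (Sigma.ι _ k), hid, zero_comp, zero_comp])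
      rw [this, comp_zero]
    exact ⟨fun g f _ => ⟨0, by rw [comp_zero, ← Category.comp_id g, hy, comp_zero]⟩⟩
end

section
/- Let C be a Grothendieck abelian category and x a nonzero object such that every object of C is isomorphic to a coproduct of copies of x. If y and z are two objects each with the property that every object of C is a coproduct of copies of it, then y ≅ z. -/
open CategoryTheory CategoryTheory.Limits

lemma bumby_aux {C : Type u} [Category.{v} C] [Abelian C] [HasColimits C]
    (hinj : ∀ w : C, Injective w) {y z : C} (f : y ⟶ z) (g : z ⟶ y) [Mono f] [Mono g] :
    Nonempty (y ≅ z) := by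
  have := hasCoproductsOfShape_of_hasCoproducts.{v} (C := C)
  let a (ρ : y ⟶ z) : ℕ → (y ⟶ y) := fun n => Nat.rec (𝟙 y - ρ ≫ g) (fun _ t => t ≫ f ≫ g) n
  have := hinj z
  let ρ : y ⟶ z := Injective.factorThru (𝟙 z) g
  have hρ : g ≫ ρ = 𝟙 z := Injective.comp_factorThru _ _
  let h : (∐ fun _ : ULift.{v} ℕ => y) ⟶ y := Sigma.desc fun n => a ρ n.down
  let p := factorThruImage h
  let m := image.ι h
  have hpm : p ≫ m = h := image.fac h
  have := hinj (image h)
  let σ : z ⟶ image h := Injective.factorThru (𝟙 _) (m ≫ f)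
  have hσ : m ≫ f ≫ σ = 𝟙 _ := by
    have := Injective.comp_factorThru (𝟙 (image h)) (m ≫ f)
    rwa [Category.assoc] at this
  let e : z ⟶ z := 𝟙 z - σ ≫ m ≫ f
  have h1 : (m ≫ f) ≫ e = 0 := by
    simp [e, reassoc_of% hσ]
  have h2 : e ≫ σ = 0 := by simp [e, hσ]
  have h3 : m ≫ ρ ≫ e = 0 := by
    rw [← cancel_epi p, reassoc_of% hpm, comp_zero]
    apply Sigma.hom_ext
    rintro ⟨n⟩
    simp only [h, colimit.ι_desc_assoc, Cofan.mk_ι_app, comp_zero]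
    cases n with
    | zero => simp [a, reassoc_of% hρ]
    | succ n =>
      have : a ρ (n+1) = a ρ n ≫ f ≫ g := rfl
      have h5 : a ρ n = Sigma.ι (fun _ : ULift.{v} ℕ => y) ⟨n⟩ ≫ p ≫ m := by
        rw [hpm]; simp [h]
      simp only [Category.assoc] at h1
      simp [this, reassoc_of% hρ, h5, h1]
  -- the shift map
  have h4 : ∃ k : image h ⟶ image h, m ≫ f ≫ g = k ≫ m := by
    have : (m ≫ f ≫ g) ≫ cokernel.π m = 0 := by
      rw [← cancel_epi p, comp_zero]
      simp only [Category.assoc]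
      rw [reassoc_of% hpm]
      apply Sigma.hom_ext
      rintro ⟨n⟩
      have h5 : a ρ n ≫ f ≫ g = Sigma.ι (fun _ : ULift.{v} ℕ => y) ⟨n+1⟩ ≫ p ≫ m := by
        rw [hpm]; simp [h]; rfl
      have h6 : Sigma.ι (fun _ : ULift.{v} ℕ => y) ⟨n⟩ ≫ h = a ρ n := by simp [h]
      rw [reassoc_of% h6, reassoc_of% h5]
      simp
    exact ⟨Abelian.monoLift m _ this, (Abelian.monoLift_comp m _ this).symm⟩
  obtain ⟨k, hk⟩ := h4
  have h7 : 𝟙 y - ρ ≫ g = Sigma.ι (fun _ : ULift.{v} ℕ => y) ⟨0⟩ ≫ p ≫ m := by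
    rw [hpm]; simp [h, a]
  let l : y ⟶ image h := Sigma.ι (fun _ : ULift.{v} ℕ => y) ⟨0⟩ ≫ p + ρ ≫ σ ≫ k
  have hl : l ≫ m = 𝟙 y - ρ ≫ e ≫ g := by
    simp only [l, Preadditive.add_comp, Category.assoc, ← h7, ← hk, e, Preadditive.sub_comp,
      Preadditive.comp_sub, Category.id_comp]
    abel
  have hml : m ≫ l = 𝟙 _ := by
    rw [← cancel_mono m, Category.assoc, hl]
    simp [reassoc_of% h3]
  have hee : e ≫ e = e := by
    conv_lhs => enter [2]; simp only [e]
    simp [reassoc_of% h2]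
  have hegl : e ≫ g ≫ l = 0 := by
    rw [← cancel_mono m, Category.assoc, Category.assoc, hl]
    simp [reassoc_of% hρ, reassoc_of% hee]
  simp only [Category.assoc] at h1
  refine ⟨⟨l ≫ m ≫ f + ρ ≫ e, σ ≫ m + e ≫ g, ?_, ?_⟩⟩
  · simp [reassoc_of% hσ, reassoc_of% h1, reassoc_of% h2, reassoc_of% hee, hl]
  · simp [reassoc_of% hml, h3, reassoc_of% hegl, reassoc_of% hρ, hee]
    simp [e]

lemma sigma_split {C : Type u} [Category.{v} C] [Abelian C] [HasColimits C] (x : C)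
    {S T : Type v} (i : S ↪ T) :
    Nonempty (Retract (∐ fun _ : S => x) (∐ fun _ : T => x)) := by
  classical
  refine ⟨⟨Sigma.desc fun s => Sigma.ι (fun _ : T => x) (i s),
    Sigma.desc fun t => if ht : ∃ s, i s = t then Sigma.ι (fun _ : S => x) ht.choose else 0, ?_⟩⟩
  apply Sigma.hom_ext
  intro s
  have hs : ∃ s', i s' = i s := ⟨s, rfl⟩
  have := i.injective hs.choose_spec
  simp only [colimit.ι_desc_assoc, Cofan.mk_ι_app, colimit.ι_desc, dif_pos hs, Category.comp_id]
  rw [this]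

lemma all_injective {C : Type u} [Category.{v} C] [Abelian C] [HasColimits C]
    [EnoughInjectives C] (x : C) (hx0 : ¬ IsZero x)
    (hx : ∀ w : C, ∃ S : Type v, Nonempty (w ≅ ∐ (fun _ : S => x))) (w : C) : Injective w := by
  classical
  obtain ⟨S, ⟨φ⟩⟩ := hx w
  let P : Type v := Set (x ⟶ ∐ fun _ : S => x)
  let I := Injective.under (∐ fun _ : P => x)
  obtain ⟨T, ⟨ψ⟩⟩ := hx I
  have hid : 𝟙 x ≠ 0 := fun h => hx0 ((IsZero.iff_id_eq_zero x).2 h)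
  rcases Function.Embedding.total S T with ⟨⟨i⟩⟩ | ⟨⟨i⟩⟩
  · obtain ⟨r⟩ := sigma_split x i
    refine ⟨fun {X Y} a b _ => ?_⟩
    refine ⟨Injective.factorThru (a ≫ φ.hom ≫ r.i ≫ ψ.inv) b ≫ ψ.hom ≫ r.r ≫ φ.inv, ?_⟩
    rw [← Category.assoc, Injective.comp_factorThru]
    simp
  · exfalso
    obtain ⟨r⟩ := sigma_split x i
    let j : (∐ fun _ : P => x) ⟶ ∐ fun _ : S => x := Injective.ι _ ≫ ψ.hom ≫ r.i
    have : Mono r.i := inferInstance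
    have : Mono j := inferInstance
    refine Function.cantor_injective
      (fun q : Set (x ⟶ ∐ fun _ : S => x) => Sigma.ι (fun _ : P => x) q ≫ j) ?_
    intro q q' hq
    by_contra hne
    have h1 := (cancel_mono j).1 hq
    have h2 := congrArg (fun t => t ≫ Sigma.desc (fun p : P => if p = q then 𝟙 x else 0)) h1
    have hne' : ¬ (q' = q) := fun h => hne h.symm
    simp [hne'] at h2
    exact hid h2

lemma exists_mono_aux {C : Type u} [Category.{v} C] [Abelian C] [HasColimits C]
    (y z : C) (hy0 : ¬ IsZero y)
    (hz : ∀ w : C, ∃ S : Type v, Nonempty (w ≅ ∐ (fun _ : S => z))) :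
    ∃ f : z ⟶ y, Mono f := by
  obtain ⟨S, ⟨φ⟩⟩ := hz y
  rcases isEmpty_or_nonempty S with hS | ⟨⟨s⟩⟩
  · exfalso
    apply hy0
    rw [IsZero.iff_id_eq_zero, ← cancel_epi φ.inv]
    apply Sigma.hom_ext
    intro s
    exact hS.elim s
  · have : Mono (Sigma.ι (fun _ : S => z) s) := by
      have : IsSplitMono (Sigma.ι (fun _ : S => z) s) :=
        ⟨⟨⟨Sigma.desc fun _ => 𝟙 z, by simp⟩⟩⟩
      infer_instance
    exact ⟨Sigma.ι (fun _ : S => z) s ≫ φ.inv, inferInstance⟩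

lemma nonzero_aux {C : Type u} [Category.{v} C] [Abelian C] [HasColimits C]
    (x : C) (hx0 : ¬ IsZero x) (y : C)
    (hy : ∀ w : C, ∃ S : Type v, Nonempty (w ≅ ∐ (fun _ : S => y))) : ¬ IsZero y := by
  intro h
  obtain ⟨S, ⟨φ⟩⟩ := hy x
  apply hx0
  rw [IsZero.iff_id_eq_zero, ← cancel_epi φ.inv]
  apply Sigma.hom_ext
  intro s
  exact h.eq_of_src _ _

/-- In a Grothendieck abelian category (abelian, cocomplete, with exact filtered
colimits (AB5) and a separator) in which every object is a coproduct of copies of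
a fixed nonzero object `x`, any two objects `y`, `z` such that every object is a
coproduct of copies of `y` (resp. of `z`) are isomorphic. -/
theorem stmt19 {C : Type u} [Category.{v} C] [Abelian C]
    [HasColimits C] [HasFilteredColimits C] [AB5 C] [HasSeparator C]
    (x : C) (hx0 : ¬ IsZero x)
    (hx : ∀ w : C, ∃ S : Type v, Nonempty (w ≅ ∐ (fun _ : S => x)))
    (y z : C)
    (hy : ∀ w : C, ∃ S : Type v, Nonempty (w ≅ ∐ (fun _ : S => y)))
    (hz : ∀ w : C, ∃ S : Type v, Nonempty (w ≅ ∐ (fun _ : S => z))) :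
    Nonempty (y ≅ z) := by
  have : IsGrothendieckAbelian.{v} C := {}
  have : EnoughInjectives C := IsGrothendieckAbelian.enoughInjectives.{v}
  obtain ⟨f, hf⟩ := exists_mono_aux z y (nonzero_aux x hx0 z hz) hy
  obtain ⟨g, hg⟩ := exists_mono_aux y z (nonzero_aux x hx0 y hy) hz
  exact bumby_aux (all_injective x hx0 hx) f g
end
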